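/- Let A be an n-by-n weighted shift matrix (n ≥ 3) with nonzero weights a_1, …, a_n, and let p_A(x, y, z) = det(x·Re A + y·Im A + z·I_n) be its Kippenhahn polynomial, regarded as a homogeneous polynomial of degree n in ℂ[x, y, z]. Suppose p_A is reducible and q(x, y, z) is an irreducible factor of p_A of degree k, normalized so that the coefficient of z^k in q is 1. Then k divides n and p_A(x, y, z) = Π_{j=1}^{n/k} q(x·cos θ_j + y·sin θ_j, −x·sin θ_j + y·cos θ_j, z), where θ_j = 2(j−1)π/n for j = 1, …, n/k. -/

import Mathlib

open Matrix

/-- The n-by-n weighted shift matrix with weights `a 0, …, a (n-1)`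
(representing `a_1, …, a_n`): the `(i, i+1)` entry is `a i` (cyclically). -/
def wsMatrix {n : ℕ} (a : Fin n → ℂ) : Matrix (Fin n) (Fin n) ℂ :=
  fun i j => if (j : ℕ) = ((i : ℕ) + 1) % n then a i else 0

/-- Two square complex matrices are unitarily equivalent if `B = U* A U`
for some unitary `U`. -/
def UnitarilyEquiv {n : ℕ} (A B : Matrix (Fin n) (Fin n) ℂ) : Prop :=
  ∃ U : Matrix (Fin n) (Fin n) ℂ, U ∈ Matrix.unitaryGroup (Fin n) ℂ ∧ B = Uᴴ * A * U

open MvPolynomial in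
/-- The Kippenhahn polynomial `p_A(x,y,z) = det(x·Re A + y·Im A + z·I)` of a
square complex matrix `A`, as a homogeneous polynomial in `ℂ[x, y, z]`
(variables indexed by `Fin 3`: `X 0 = x`, `X 1 = y`, `X 2 = z`). -/
noncomputable def kipPoly {n : ℕ} (A : Matrix (Fin n) (Fin n) ℂ) :
    MvPolynomial (Fin 3) ℂ :=
  Matrix.det
    ((X 0 : MvPolynomial (Fin 3) ℂ) • ((1 / 2 : ℂ) • (A + Aᴴ)).map MvPolynomial.C +
     (X 1 : MvPolynomial (Fin 3) ℂ) • ((1 / (2 * Complex.I) : ℂ) • (A - Aᴴ)).map MvPolynomial.C +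
     (X 2 : MvPolynomial (Fin 3) ℂ) • (1 : Matrix (Fin n) (Fin n) (MvPolynomial (Fin 3) ℂ)))

open MvPolynomial in
noncomputable def kD (t : ℂ) : MvPolynomial (Fin 3) ℂ →ₐ[ℂ] MvPolynomial (Fin 3) ℂ :=
  bind₁ ![C t * X 0, C t⁻¹ * X 1, X 2]

open MvPolynomial in
lemma kD_coeff (t : ℂ) (q : MvPolynomial (Fin 3) ℂ) (m : Fin 3 →₀ ℕ) :
    coeff m (kD t q) = t ^ m 0 * t⁻¹ ^ m 1 * coeff m q := by
  induction q using MvPolynomial.induction_on' with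
  | monomial u c =>
    have : kD t (monomial u c) = C (t ^ u 0 * t⁻¹ ^ u 1) * monomial u c := by
      rw [kD, bind₁_monomial, monomial_eq, Finsupp.prod_fintype _ _ (by simp)]
      have h : (Finset.prod u.support fun i => (![C t * X 0, C t⁻¹ * X 1, X 2] i : MvPolynomial (Fin 3) ℂ) ^ u i) = ∏ i, (![C t * X 0, C t⁻¹ * X 1, X 2] i : MvPolynomial (Fin 3) ℂ) ^ u i := by
        exact Finset.prod_subset (Finset.subset_univ _) (by
          intro i _ hi
          simp [Finsupp.notMem_support_iff.mp hi])
      try rw [h]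
      simp only [Fin.prod_univ_three, Matrix.cons_val_zero, Matrix.cons_val_one,
        Matrix.cons_val, mul_pow, C_mul, C_pow]
      ring
    rw [this, coeff_C_mul, coeff_monomial]
    split_ifs with h
    · rw [h]
    · simp
  | add p q hp hq => rw [map_add, coeff_add, coeff_add, hp, hq]; ring

open MvPolynomial in
lemma kD_totalDegree {t : ℂ} (ht : t ≠ 0) (q : MvPolynomial (Fin 3) ℂ) :
    (kD t q).totalDegree = q.totalDegree := by
  have : (kD t q).support = q.support := by
    ext m
    simp [mem_support_iff, kD_coeff, ht]
  rw [totalDegree, totalDegree, this]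

lemma kD_mul (s t : ℂ) (q : MvPolynomial (Fin 3) ℂ) : kD s (kD t q) = kD (s * t) q := by
  ext m
  simp only [kD_coeff, mul_pow, mul_inv]; ring

lemma kD_one (q : MvPolynomial (Fin 3) ℂ) : kD 1 q = q := by
  ext m
  simp [kD_coeff]

noncomputable def kDE (t : ℂ) (ht : t ≠ 0) : MvPolynomial (Fin 3) ℂ ≃ₐ[ℂ] MvPolynomial (Fin 3) ℂ :=
  AlgEquiv.ofAlgHom (kD t) (kD t⁻¹)
    (AlgHom.ext fun q => by simp [kD_mul, ht, kD_one])
    (AlgHom.ext fun q => by simp [kD_mul, ht, kD_one])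

lemma kD_irr {t : ℂ} (ht : t ≠ 0) {q : MvPolynomial (Fin 3) ℂ} (hq : Irreducible q) :
    Irreducible (kD t q) :=
  (MulEquiv.irreducible_iff (kDE t ht)).mpr hq

open MvPolynomial in
lemma kcoeff_mul (i : Fin 3) (A B : MvPolynomial (Fin 3) ℂ) (a b : ℕ)
    (hA : A.totalDegree ≤ a) (hB : B.totalDegree ≤ b) :
    coeff (Finsupp.single i (a + b)) (A * B) =
      coeff (Finsupp.single i a) A * coeff (Finsupp.single i b) B := by
  classical
  rw [coeff_mul, Finsupp.antidiagonal_single, Finset.sum_map, Finset.sum_eq_single (a, b)]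
  · simp
  · rintro ⟨c, d⟩ h hne
    have h : c + d = a + b := Finset.HasAntidiagonal.mem_antidiagonal.mp h
    change coeff (Finsupp.single i c) A * coeff (Finsupp.single i d) B = 0
    by_cases hc : a < c
    · rw [coeff_eq_zero_of_totalDegree_lt (f := A)]
      · simp
      · rw [← Finsupp.degree_apply]
        simpa using lt_of_le_of_lt hA hc
    · have hd : b < d := by
        by_contra hd
        exact hne (by ext <;> simp <;> omega)
      rw [coeff_eq_zero_of_totalDegree_lt (f := B)]
      · simp
      · rw [← Finsupp.degree_apply]
        simpa using lt_of_le_of_lt hB hd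
  · simp

open MvPolynomial in
lemma kD_all {n : ℕ} {ζ : ℂ} (hz : IsPrimitiveRoot ζ n) (hn : n ≠ 0)
    (S : MvPolynomial (Fin 3) ℂ) (hS : kD ζ S = S) (hd : S.totalDegree < n) (t : ℂ) (ht : t ≠ 0) :
    kD t S = S := by
  have hz0 : ζ ≠ 0 := hz.ne_zero hn
  ext m
  rw [kD_coeff]
  by_cases hc : coeff m S = 0
  · simp [hc]
  have h1 := congrArg (coeff m) hS
  rw [kD_coeff] at h1
  have hm := le_totalDegree (mem_support_iff.mpr hc)
  have hm' : m 0 + m 1 + m 2 ≤ S.totalDegree := by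
    rwa [Finsupp.sum_fintype _ _ (by simp), Fin.sum_univ_three] at hm
  have h2 : ζ ^ m 0 * ζ⁻¹ ^ m 1 = 1 := mul_right_cancel₀ hc (by rw [h1, one_mul])
  have h3 : ζ ^ m 0 = ζ ^ m 1 := by
    rw [inv_pow] at h2
    exact (mul_inv_eq_one₀ (pow_ne_zero _ hz0)).mp h2
  have h4 := hz.pow_inj (by omega) (by omega) h3
  rw [h4, ← mul_pow, mul_inv_cancel₀ ht, one_pow, one_mul]

open MvPolynomial in
lemma kmain {n k : ℕ} {ζ : ℂ} (hz : IsPrimitiveRoot ζ n) (hn : n ≠ 0)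
    (P q : MvPolynomial (Fin 3) ℂ) (hP : kD ζ P = P) (hPd : P.totalDegree = n)
    (hP1 : coeff (Finsupp.single 2 n) P = 1) (hP2 : ∃ t : ℂ, t ≠ 0 ∧ kD t P ≠ P)
    (hq : Irreducible q) (hdvd : q ∣ P) (hdeg : q.totalDegree = k)
    (hnorm : coeff (Finsupp.single 2 k) q = 1) :
    k ∣ n ∧ P = ∏ j ∈ Finset.range (n / k), kD (ζ ^ j) q := by
  classical
  have hz0 : ζ ≠ 0 := hz.ne_zero hn
  have hk : 0 < k := by
    rcases Nat.eq_zero_or_pos k with h | h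
    · rw [h] at hdeg
      rw [totalDegree_eq_zero_iff_eq_C] at hdeg
      rw [hdeg] at hq
      exact absurd ((isUnit_iff_ne_zero.mpr (fun h0 => hq.ne_zero (by rw [h0, C_0]))).map C) hq.not_isUnit
    · exact h
  have hPj : ∀ j : ℕ, kD (ζ ^ j) P = P := by
    intro j
    induction j with
    | zero => simp [kD_one]
    | succ j ih => rw [pow_succ, ← kD_mul, hP, ih]
  have hex : ∃ m, 0 < m ∧ kD (ζ ^ m) q = q :=
    ⟨n, Nat.pos_of_ne_zero hn, by rw [hz.pow_eq_one, kD_one]⟩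
  obtain ⟨m, ⟨hm0, hm⟩, hmin⟩ : ∃ m, (0 < m ∧ kD (ζ ^ m) q = q) ∧
      ∀ l < m, ¬ (0 < l ∧ kD (ζ ^ l) q = q) :=
    ⟨Nat.find hex, Nat.find_spec hex, fun l hl => Nat.find_min hex hl⟩
  have hcf : ∀ j : ℕ, coeff (Finsupp.single 2 k) (kD (ζ ^ j) q) = 1 := by
    intro j; rw [kD_coeff, hnorm]; simp
  have hirr : ∀ j : ℕ, Irreducible (kD (ζ ^ j) q) := fun j => kD_irr (pow_ne_zero _ hz0) hq
  have hkey : ∀ i j : ℕ, i < j → j < m → ¬ Associated (kD (ζ ^ i) q) (kD (ζ ^ j) q) := by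
    intro i j hij hj h
    obtain ⟨u, hu⟩ := h
    obtain ⟨c, _, hc⟩ := (MvPolynomial.isUnit_iff_eq_C_of_isReduced).mp u.isUnit
    rw [hc] at hu
    have h1 := congrArg (coeff (Finsupp.single 2 k)) hu
    rw [mul_comm, coeff_C_mul, hcf, hcf, mul_one] at h1
    rw [h1, C_1, mul_one] at hu
    refine hmin (j - i) (by omega) ⟨by omega, ?_⟩
    have h2 : kD ((ζ ^ i)⁻¹) (kD (ζ ^ i) q) = kD ((ζ ^ i)⁻¹) (kD (ζ ^ j) q) := by rw [hu]
    rw [kD_mul, kD_mul, inv_mul_cancel₀ (pow_ne_zero _ hz0), kD_one] at h2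
    rw [pow_sub₀ _ hz0 hij.le, mul_comm, ← h2]
  set Q := ∏ j ∈ Finset.range m, kD (ζ ^ j) q with hQ
  have hQP : Q ∣ P := by
    apply Finset.prod_dvd_of_isRelPrime
    · intro i hi j hj hij
      have hi' : i < m := by simpa using hi
      have hj' : j < m := by simpa using hj
      change IsRelPrime _ _
      rw [(hirr i).isRelPrime_iff_not_dvd]
      intro hd
      have := (hirr i).associated_of_dvd (hirr j) hd
      rcases lt_or_gt_of_ne hij with h | h
      · exact hkey i j h hj' this
      · exact hkey j i h hi' this.symm
    · intro j _
      rw [← hPj j]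
      exact map_dvd _ hdvd
  have hQinv : kD ζ Q = Q := by
    have h1 : kD ζ Q = ∏ j ∈ Finset.range m, kD (ζ ^ (j + 1)) q := by
      rw [hQ, map_prod]
      exact Finset.prod_congr rfl fun j _ => by rw [kD_mul, pow_succ']
    have h2 : q * kD ζ Q = q * Q := by
      rw [h1, hQ]
      have a1 := Finset.prod_range_succ (fun j => kD (ζ ^ j) q) m
      have a2 := Finset.prod_range_succ' (fun j => kD (ζ ^ j) q) m
      simp only [pow_zero, kD_one, hm] at a1 a2
      rw [mul_comm q, mul_comm q, ← a2, a1]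
    exact mul_left_cancel₀ hq.ne_zero h2
  have hQd : ∀ l : ℕ, (∏ j ∈ Finset.range l, kD (ζ ^ j) q).totalDegree = l * k ∧
      coeff (Finsupp.single 2 (l * k)) (∏ j ∈ Finset.range l, kD (ζ ^ j) q) = 1 := by
    intro l
    induction l with
    | zero => simp
    | succ l ih =>
      have hdd : (kD (ζ ^ l) q).totalDegree = k := by rw [kD_totalDegree (pow_ne_zero _ hz0), hdeg]
      rw [Finset.prod_range_succ]
      constructor
      · rw [totalDegree_mul_of_isDomain (Finset.prod_ne_zero_iff.mpr fun j _ => (hirr j).ne_zero)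
          (hirr l).ne_zero, ih.1, hdd]
        ring
      · rw [add_mul, one_mul, kcoeff_mul _ _ _ _ _ ih.1.le hdd.le, ih.2, hcf, one_mul]
  obtain ⟨S, hS⟩ := hQP
  have hP0 : P ≠ 0 := by rintro rfl; simp at hP1
  have hQ0 : Q ≠ 0 := by rintro h; rw [h, zero_mul] at hS; exact hP0 hS
  have hS0 : S ≠ 0 := by rintro h; rw [h, mul_zero] at hS; exact hP0 hS
  have hSinv : kD ζ S = S := by
    apply mul_left_cancel₀ hQ0
    rw [hS, map_mul, hQinv] at hP
    exact hP
  have hdegs : m * k + S.totalDegree = n := by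
    rw [← hPd, hS, totalDegree_mul_of_isDomain hQ0 hS0, (hQd m).1]
  have hmk0 : 0 < m * k := Nat.mul_pos hm0 hk
  have hmk : m * k = n := by
    by_contra hne
    obtain ⟨t, ht, hPt⟩ := hP2
    apply hPt
    rw [hS, map_mul, kD_all hz hn Q hQinv (by rw [(hQd m).1]; omega) t ht,
      kD_all hz hn S hSinv (by omega) t ht]
  have hS1 : S.totalDegree = 0 := by omega
  rw [totalDegree_eq_zero_iff_eq_C] at hS1
  have hS2 : S = 1 := by
    rw [hS1] at hS
    rw [hS, mul_comm, coeff_C_mul, ← hmk, (hQd m).2, mul_one] at hP1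
    rw [hS1, hP1, C_1]
  refine ⟨⟨m, by rw [← hmk, mul_comm]⟩, ?_⟩
  rw [← hmk, Nat.mul_div_cancel _ hk, hS, hS2, mul_one]

open MvPolynomial in
lemma ktd_bind (f : Fin 3 → MvPolynomial (Fin 3) ℂ) (hf : ∀ i, (f i).totalDegree ≤ 1)
    (q : MvPolynomial (Fin 3) ℂ) : (bind₁ f q).totalDegree ≤ q.totalDegree := by
  have h : bind₁ f q = ∑ m ∈ q.support, C (coeff m q) * ∏ i, f i ^ m i := by
    rw [bind₁, aeval_def, eval₂_eq']; rfl
  rw [h]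
  apply totalDegree_finsetSum_le
  intro m hm
  refine (totalDegree_mul _ _).trans ?_
  rw [totalDegree_C, zero_add]
  refine (totalDegree_finsetProd _ _).trans ?_
  refine le_trans ?_ (le_totalDegree hm)
  rw [Finsupp.sum_fintype _ _ (by simp)]
  refine Finset.sum_le_sum fun i _ => (totalDegree_pow _ _).trans ?_
  calc m i * (f i).totalDegree ≤ m i * 1 := Nat.mul_le_mul_left _ (hf i)
    _ = m i := mul_one _

open MvPolynomial in
noncomputable def kT : MvPolynomial (Fin 3) ℂ →ₐ[ℂ] MvPolynomial (Fin 3) ℂ :=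
  bind₁ ![X 0 + X 1, C Complex.I * X 0 + C (-Complex.I) * X 1, X 2]

open MvPolynomial in
noncomputable def kT' : MvPolynomial (Fin 3) ℂ →ₐ[ℂ] MvPolynomial (Fin 3) ℂ :=
  bind₁ ![C (1/2) * X 0 + C (-Complex.I/2) * X 1, C (1/2) * X 0 + C (Complex.I/2) * X 1, X 2]

open MvPolynomial in
lemma ktd_lin (a b : ℂ) (i j : Fin 3) :
    (C a * X i + C b * X j : MvPolynomial (Fin 3) ℂ).totalDegree ≤ 1 := by
  have h : ∀ (a : ℂ) (i : Fin 3), (C a * X i : MvPolynomial (Fin 3) ℂ).totalDegree ≤ 1 := by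
    intro a i
    refine (totalDegree_mul _ _).trans ?_
    simp
  exact (totalDegree_add _ _).trans (max_le (h a i) (h b j))

open MvPolynomial in
noncomputable def kTE : MvPolynomial (Fin 3) ℂ ≃ₐ[ℂ] MvPolynomial (Fin 3) ℂ :=
  AlgEquiv.ofAlgHom kT kT'
    (by
      have hI : (C Complex.I * C Complex.I : MvPolynomial (Fin 3) ℂ) = -1 := by
        rw [← C_mul, Complex.I_mul_I]; simp
      have h2 : (C 2⁻¹ * 2 : MvPolynomial (Fin 3) ℂ) = 1 := by
        rw [show (2 : MvPolynomial (Fin 3) ℂ) = C 2 from (map_ofNat C 2).symm, ← C_mul]; simp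
      apply MvPolynomial.algHom_ext
      intro i
      fin_cases i <;> simp [kT, kT', div_eq_mul_inv] <;> grind)
    (by
      have hI : (C Complex.I * C Complex.I : MvPolynomial (Fin 3) ℂ) = -1 := by
        rw [← C_mul, Complex.I_mul_I]; simp
      have h2 : (C 2⁻¹ * 2 : MvPolynomial (Fin 3) ℂ) = 1 := by
        rw [show (2 : MvPolynomial (Fin 3) ℂ) = C 2 from (map_ofNat C 2).symm, ← C_mul]; simp
      apply MvPolynomial.algHom_ext
      intro i
      fin_cases i <;> simp [kT, kT', div_eq_mul_inv] <;> grind)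

lemma kTE_apply (q : MvPolynomial (Fin 3) ℂ) : kTE q = kT q := rfl

lemma kT_inj {p q : MvPolynomial (Fin 3) ℂ} (h : kT p = kT q) : p = q := kTE.injective h

open MvPolynomial in
lemma kT_totalDegree (q : MvPolynomial (Fin 3) ℂ) : (kT q).totalDegree = q.totalDegree := by
  apply le_antisymm
  · apply ktd_bind
    intro i
    fin_cases i
    · simpa using ktd_lin 1 1 0 1
    · exact ktd_lin _ _ 0 1
    · simp
  · have h : q = kT' (kT q) := (kTE.symm_apply_apply q).symm
    conv_lhs => rw [h]
    apply ktd_bind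
    intro i
    fin_cases i
    · exact ktd_lin _ _ 0 1
    · exact ktd_lin _ _ 0 1
    · simp

open MvPolynomial in
noncomputable def kS : MvPolynomial (Fin 3) ℂ →ₐ[ℂ] Polynomial ℂ :=
  aeval ![0, 0, Polynomial.X]

open MvPolynomial in
lemma kS_coeff (k : ℕ) (q : MvPolynomial (Fin 3) ℂ) :
    (kS q).coeff k = coeff (Finsupp.single 2 k) q := by
  classical
  induction q using MvPolynomial.induction_on' with
  | monomial u c =>
    rw [kS, aeval_monomial, Finsupp.prod_fintype _ _ (by simp), coeff_monomial]
    simp only [Fin.prod_univ_three, Matrix.cons_val_zero, Matrix.cons_val_one,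
        Matrix.cons_val]
    have hu : u = Finsupp.single 2 k ↔ u 0 = 0 ∧ u 1 = 0 ∧ u 2 = k := by
      rw [Finsupp.ext_iff, Fin.forall_fin_succ, Fin.forall_fin_succ, Fin.forall_fin_succ]
      simp
    by_cases h0 : u 0 = 0
    · by_cases h1 : u 1 = 0
      · simp [hu, h0, h1, Polynomial.coeff_X_pow, eq_comm]
      · simp [hu, h1]
    · simp [hu, h0]
  | add p q hp hq => rw [map_add, Polynomial.coeff_add, coeff_add, hp, hq]

open MvPolynomial in
lemma kT_coeff (k : ℕ) (q : MvPolynomial (Fin 3) ℂ) :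
    coeff (Finsupp.single 2 k) (kT q) = coeff (Finsupp.single 2 k) q := by
  rw [← kS_coeff, ← kS_coeff]
  have : kS.comp kT = kS := by
    apply MvPolynomial.algHom_ext
    intro i
    fin_cases i <;> simp [kS, kT]
  rw [← AlgHom.comp_apply, this]

open MvPolynomial in
/-- the matrix in the new coordinates -/
noncomputable def kM {n : ℕ} (A : Matrix (Fin n) (Fin n) ℂ) :
    Matrix (Fin n) (Fin n) (MvPolynomial (Fin 3) ℂ) :=
  fun i j => C (A i j) * X 0 + C (star (A j i)) * X 1 + if i = j then X 2 else 0

open MvPolynomial in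
lemma kT_kip {n : ℕ} (A : Matrix (Fin n) (Fin n) ℂ) : kT (kipPoly A) = (kM A).det := by
  rw [kipPoly, AlgHom.map_det]
  congr 1
  have hI : (C Complex.I * C Complex.I : MvPolynomial (Fin 3) ℂ) = -1 := by
    rw [← C_mul, Complex.I_mul_I]; simp
  have h2 : (C 2⁻¹ * 2 : MvPolynomial (Fin 3) ℂ) = 1 := by
    rw [show (2 : MvPolynomial (Fin 3) ℂ) = C 2 from (map_ofNat C 2).symm, ← C_mul]; simp
  ext1 i j
  by_cases h : i = j
  · subst h
    simp [kM, kT, Matrix.one_apply]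
    grind
  · simp [kM, kT, Matrix.one_apply, h]
    grind

open MvPolynomial in
lemma kM_coeff {n : ℕ} (A : Matrix (Fin n) (Fin n) ℂ) :
    coeff (Finsupp.single 2 n) (kM A).det = 1 := by
  rw [← kS_coeff, AlgHom.map_det]
  have : kS.mapMatrix (kM A) = (Polynomial.X : Polynomial ℂ) • (1 : Matrix (Fin n) (Fin n) (Polynomial ℂ)) := by
    ext1 i j
    by_cases h : i = j <;> simp [kM, kS, Matrix.one_apply, h]
  rw [this, Matrix.det_smul]
  simp

open MvPolynomial in
lemma kM_totalDegree {n : ℕ} (A : Matrix (Fin n) (Fin n) ℂ) :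
    (kM A).det.totalDegree = n := by
  apply le_antisymm
  · rw [Matrix.det_apply]
    apply totalDegree_finsetSum_le
    intro σ _
    refine (totalDegree_smul_le _ _).trans ?_
    refine (totalDegree_finsetProd _ _).trans ?_
    calc _ ≤ ∑ i : Fin n, 1 := Finset.sum_le_sum fun i _ => by
            refine (totalDegree_add _ _).trans (max_le (ktd_lin _ _ _ _) ?_)
            split_ifs <;> simp
      _ = n := by simp
  · have h := le_totalDegree (p := (kM A).det) (s := Finsupp.single 2 n)
      (mem_support_iff.mpr (by rw [kM_coeff]; exact one_ne_zero))
    simpa using h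

open MvPolynomial in
lemma kM_inv {n : ℕ} {ζ : ℂ} (hz : ζ ^ n = 1) (hz0 : ζ ≠ 0) (a : Fin n → ℂ) :
    kD ζ (kM (wsMatrix a)).det = (kM (wsMatrix a)).det := by
  rw [AlgHom.map_det]
  set L : Matrix (Fin n) (Fin n) (MvPolynomial (Fin 3) ℂ) :=
    Matrix.diagonal fun i => C (ζ ^ (i : ℕ)) with hL
  have hL0 : L.det ≠ 0 := by
    rw [hL, Matrix.det_diagonal, Finset.prod_ne_zero_iff]
    intro i _
    simp [hz0]
  have hmod : ∀ i : ℕ, ζ ^ ((i + 1) % n) = ζ ^ (i + 1) := fun i => (pow_eq_pow_mod _ hz).symm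
  have key : L * (kD ζ).mapMatrix (kM (wsMatrix a)) = kM (wsMatrix a) * L := by
    ext1 i j
    rw [hL, Matrix.diagonal_mul, Matrix.mul_diagonal]
    have hA : ζ ^ (i : ℕ) * (wsMatrix a i j * ζ) = wsMatrix a i j * ζ ^ (j : ℕ) := by
      unfold wsMatrix
      split_ifs with h
      · rw [h, hmod]; ring
      · simp
    have hB : ζ ^ (i : ℕ) * (star (wsMatrix a j i) * ζ⁻¹) = star (wsMatrix a j i) * ζ ^ (j : ℕ) := by
      unfold wsMatrix
      split_ifs with h
      · rw [h, hmod]; field_simp; ring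
      · simp
    have hA' := congrArg (C : ℂ →+* MvPolynomial (Fin 3) ℂ) hA
    have hB' := congrArg (C : ℂ →+* MvPolynomial (Fin 3) ℂ) hB
    rw [C_mul, C_mul, C_mul] at hA' hB'
    have e : kD ζ (kM (wsMatrix a) i j) = C (wsMatrix a i j) * (C ζ * X 0) +
        C (star (wsMatrix a j i)) * (C ζ⁻¹ * X 1) + if i = j then X 2 else 0 := by
      rw [kM, map_add, map_add, map_mul, map_mul, apply_ite (kD ζ)]
      simp [kD, bind₁_C_right]
    rw [AlgHom.mapMatrix_apply, Matrix.map_apply, e, kM]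
    split_ifs with h
    · subst h
      linear_combination X 0 * hA' + X 1 * hB'
    · linear_combination X 0 * hA' + X 1 * hB'
  have := congrArg Matrix.det key
  rw [Matrix.det_mul, Matrix.det_mul, mul_comm] at this
  exact mul_right_cancel₀ hL0 this

lemma ws_det {n : ℕ} (a : Fin n → ℂ) (ha : ∀ i, a i ≠ 0) : (wsMatrix a).det ≠ 0 := by
  have h : wsMatrix a * (wsMatrix a)ᴴ = Matrix.diagonal fun i => a i * star (a i) := by
    ext i l
    have hn : 0 < n := i.pos
    rw [Matrix.mul_apply, Finset.sum_eq_single (⟨((i : ℕ) + 1) % n, Nat.mod_lt _ hn⟩ : Fin n)]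
    · by_cases hil : i = l
      · subst hil
        simp [wsMatrix, Matrix.conjTranspose_apply]
      · rw [Matrix.diagonal_apply_ne _ hil]
        have : ¬ ((i : ℕ) + 1) % n = ((l : ℕ) + 1) % n := by
          intro h
          have h' : (i : ℕ) ≡ l [MOD n] := Nat.ModEq.add_right_cancel' 1 h
          exact hil (Fin.ext (by rw [Nat.ModEq, Nat.mod_eq_of_lt i.2, Nat.mod_eq_of_lt l.2] at h'; exact h'))
        simp [wsMatrix, Matrix.conjTranspose_apply, this]
    · intro j _ hj
      have : ¬ (j : ℕ) = ((i : ℕ) + 1) % n := fun h => hj (Fin.ext h)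
      simp [wsMatrix, this]
    · simp
  intro h0
  have h1 := congrArg Matrix.det h
  rw [Matrix.det_mul, h0, zero_mul, Matrix.det_diagonal] at h1
  exact (Finset.prod_ne_zero_iff.mpr fun i _ => mul_ne_zero (ha i) (star_ne_zero.mpr (ha i))) h1.symm

open MvPolynomial in
lemma kM_not {n : ℕ} (hn : n ≠ 0) (A : Matrix (Fin n) (Fin n) ℂ) (hA : A.det ≠ 0) :
    kD 2 (kM A).det ≠ (kM A).det := by
  intro h
  have h1 := congrArg (aeval (![1, 0, 0] : Fin 3 → ℂ)) h
  rw [AlgHom.map_det, AlgHom.map_det, AlgHom.map_det] at h1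
  have e1 : (aeval (![1, 0, 0] : Fin 3 → ℂ)).mapMatrix ((kD 2).mapMatrix (kM A)) = (2 : ℂ) • A := by
    ext1 i j
    by_cases h : i = j <;> simp [kM, kD, h, mul_comm]
  have e2 : (aeval (![1, 0, 0] : Fin 3 → ℂ)).mapMatrix (kM A) = A := by
    ext1 i j
    by_cases h : i = j <;> simp [kM, h]
  rw [e1, e2, Matrix.det_smul, Fintype.card_fin] at h1
  have h2 : (2 : ℂ) ^ n = 1 := mul_right_cancel₀ hA (by rw [h1, one_mul])
  have h3 : (2 : ℕ) ^ n = 1 := by exact_mod_cast h2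
  have := Nat.one_lt_two_pow hn
  omega

open MvPolynomial in
lemma kT_rot (θ : ℝ) (q : MvPolynomial (Fin 3) ℂ) :
    kT (bind₁ ![C ((Real.cos θ : ℂ)) * X 0 + C ((Real.sin θ : ℂ)) * X 1,
      -(C ((Real.sin θ : ℂ))) * X 0 + C ((Real.cos θ : ℂ)) * X 1,
      (X 2 : MvPolynomial (Fin 3) ℂ)] q) = kD (Complex.exp (θ * Complex.I)) (kT q) := by
  have hI : (C Complex.I * C Complex.I : MvPolynomial (Fin 3) ℂ) = -1 := by
    rw [← C_mul, Complex.I_mul_I]; simp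
  have e1 : Complex.exp (θ * Complex.I) = Real.cos θ + Real.sin θ * Complex.I := by
    rw [Complex.exp_mul_I]; simp
  have e2 : (Complex.exp (θ * Complex.I))⁻¹ = Real.cos θ - Real.sin θ * Complex.I := by
    rw [← Complex.exp_neg, ← neg_mul, Complex.exp_mul_I]; simp; ring
  rw [← AlgHom.comp_apply, ← AlgHom.comp_apply]
  refine DFunLike.congr_fun (F := MvPolynomial (Fin 3) ℂ →ₐ[ℂ] MvPolynomial (Fin 3) ℂ) ?_ q
  apply MvPolynomial.algHom_ext
  intro i
  rw [kD, e2, e1]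
  generalize (Real.cos θ : ℂ) = c
  generalize (Real.sin θ : ℂ) = s
  fin_cases i <;> simp [kT] <;> grind

open MvPolynomial in
theorem stmt18 (n k : ℕ) (hn : 3 ≤ n) (a : Fin n → ℂ) (ha : ∀ i, a i ≠ 0)
    (hred : ¬ Irreducible (kipPoly (wsMatrix a)))
    (q : MvPolynomial (Fin 3) ℂ) (hq : Irreducible q)
    (hdvd : q ∣ kipPoly (wsMatrix a))
    (hdeg : q.totalDegree = k)
    (hnorm : MvPolynomial.coeff (Finsupp.single (2 : Fin 3) k) q = 1) :
    k ∣ n ∧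
      kipPoly (wsMatrix a) =
        ∏ j ∈ Finset.range (n / k),
          MvPolynomial.bind₁
            ![MvPolynomial.C ((Real.cos (2 * j * Real.pi / n) : ℂ)) * X 0 +
                MvPolynomial.C ((Real.sin (2 * j * Real.pi / n) : ℂ)) * X 1,
              -(MvPolynomial.C ((Real.sin (2 * j * Real.pi / n) : ℂ))) * X 0 +
                MvPolynomial.C ((Real.cos (2 * j * Real.pi / n) : ℂ)) * X 1,
              (X 2 : MvPolynomial (Fin 3) ℂ)] q := by
  have hn0 : n ≠ 0 := by omega
  set ζ : ℂ := Complex.exp (2 * Real.pi * Complex.I / n) with hζ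
  have hz : IsPrimitiveRoot ζ n := Complex.isPrimitiveRoot_exp n hn0
  have hP := kM_inv hz.pow_eq_one (hz.ne_zero hn0) a
  obtain ⟨h1, h2⟩ := kmain (k := k) hz hn0 (kM (wsMatrix a)).det (kT q) hP (kM_totalDegree _)
    (kM_coeff _) ⟨2, two_ne_zero, kM_not hn0 _ (ws_det a ha)⟩
    ((MulEquiv.irreducible_iff kTE).mpr hq)
    (by rw [← kT_kip]; exact map_dvd kT hdvd)
    (by rw [kT_totalDegree, hdeg]) (by rw [kT_coeff, hnorm])
  refine ⟨h1, kT_inj ?_⟩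
  rw [kT_kip, h2, map_prod]
  refine Finset.prod_congr rfl fun j _ => ?_
  rw [kT_rot, hζ, ← Complex.exp_nat_mul]
  congr 3
  push_cast
  ring
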